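/- Let F ⊆ ℕ → ℕ be unbounded with respect to ≤*. Then the subset D = F ⊔ ℕ of the van Douwen space X_F is closed and discrete, yet there is no family (U_d)_{d ∈ D} of pairwise disjoint open subsets of X_F with d ∈ U_d for every d ∈ D; in particular, X_F is not collectionwise Hausdorff. -/

import Mathlib

/-- The underlying type of the van Douwen space `X_F`:
the disjoint union `F ⊔ ℕ ⊔ (F × ℕ × ℕ)`. -/
def VDSpace (F : Set (ℕ → ℕ)) : Type := (↥F ⊕ ℕ) ⊕ (↥F × ℕ × ℕ)

namespace VDSpace

variable {F : Set (ℕ → ℕ)}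

/-- The (isolated) points of `X_F` coming from `F × ℕ × ℕ`. -/
def pt (p : ↥F × ℕ × ℕ) : VDSpace F := Sum.inr p

/-- The points of `X_F` coming from functions in `F`. -/
def fn (f : ↥F) : VDSpace F := Sum.inl (Sum.inl f)

/-- The points of `X_F` coming from natural numbers. -/
def nat (k : ℕ) : VDSpace F := Sum.inl (Sum.inr k)

/-- The basic neighborhood `O_{f,s} = {f} ∪ {(f, m, n) : f m = n, (m, n) ∉ s}` of `fn f`. -/
def basicO (f : ↥F) (s : Finset (ℕ × ℕ)) : Set (VDSpace F) :=
  {fn f} ∪ {x | ∃ m n : ℕ, (f : ℕ → ℕ) m = n ∧ (m, n) ∉ s ∧ x = pt (f, m, n)}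

/-- The basic neighborhood `U_{k,n} = {k} ∪ {(g, k, l) : g ∈ F, l ≥ n}` of `nat k`. -/
def basicU (k n : ℕ) : Set (VDSpace F) :=
  {nat k} ∪ {x | ∃ (g : ↥F) (l : ℕ), n ≤ l ∧ x = pt (g, k, l)}

/-- The topology of the van Douwen space: every point of `F × ℕ × ℕ` is isolated,
the sets `O_{f,s}` form a neighborhood basis of `f ∈ F`, and the sets `U_{k,n}` form a
neighborhood basis of `k ∈ ℕ`. -/
instance instTopVD (F : Set (ℕ → ℕ)) : TopologicalSpace (VDSpace F) :=
  TopologicalSpace.generateFrom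
    ({V | ∃ p : ↥F × ℕ × ℕ, V = {pt p}} ∪
     {V | ∃ (f : ↥F) (s : Finset (ℕ × ℕ)), V = basicO f s} ∪
     {V | ∃ k n : ℕ, V = (basicU k n : Set (VDSpace F))})

end VDSpace

/-- `f ≤* g`: eventual domination, i.e. `f n ≤ g n` for all but finitely many `n`. -/
def EvLE (f g : ℕ → ℕ) : Prop := ∀ᶠ n in Filter.atTop, f n ≤ g n

/-- The subset `D = F ⊔ ℕ` of the van Douwen space `X_F`. -/
def VDSpace.D (F : Set (ℕ → ℕ)) : Set (VDSpace F) :=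
  {x | (∃ f : ↥F, x = VDSpace.fn f) ∨ (∃ k : ℕ, x = VDSpace.nat k)}

/-- A topological space `X` is collectionwise Hausdorff if for every closed discrete `D ⊆ X`
there is a family of pairwise disjoint open sets, one around each point of `D`. -/
def CollectionwiseHausdorff (X : Type*) [TopologicalSpace X] : Prop :=
  ∀ D : Set X, IsClosed D → (∀ d ∈ D, ∃ V : Set X, IsOpen V ∧ V ∩ D = {d}) →
    ∃ U : D → Set X, (∀ d : D, IsOpen (U d) ∧ (d : X) ∈ U d) ∧
      ∀ d d' : D, d ≠ d' → Disjoint (U d) (U d')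

namespace VDSpace

theorem isOpen_singleton_pt {F : Set (ℕ → ℕ)} (p : ↥F × ℕ × ℕ) :
    IsOpen ({pt p} : Set (VDSpace F)) :=
  TopologicalSpace.isOpen_generateFrom_of_mem (Or.inl (Or.inl ⟨p, rfl⟩))

theorem isOpen_basicO {F : Set (ℕ → ℕ)} (f : ↥F) (s : Finset (ℕ × ℕ)) :
    IsOpen (basicO f s) :=
  TopologicalSpace.isOpen_generateFrom_of_mem (Or.inl (Or.inr ⟨f, s, rfl⟩))

theorem isOpen_basicU {F : Set (ℕ → ℕ)} (k n : ℕ) :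
    IsOpen (basicU k n : Set (VDSpace F)) :=
  TopologicalSpace.isOpen_generateFrom_of_mem (Or.inr ⟨k, n, rfl⟩)

theorem pt_ne_fn {F : Set (ℕ → ℕ)} (p : ↥F × ℕ × ℕ) (f : ↥F) : pt p ≠ fn f :=
  Sum.inr_ne_inl

theorem pt_ne_nat {F : Set (ℕ → ℕ)} (p : ↥F × ℕ × ℕ) (k : ℕ) : pt p ≠ nat k :=
  Sum.inr_ne_inl

theorem fn_ne_nat {F : Set (ℕ → ℕ)} (f : ↥F) (k : ℕ) : fn f ≠ nat k :=
  fun h => Sum.inl_ne_inr (Sum.inl_injective h)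

theorem fn_injective {F : Set (ℕ → ℕ)} : Function.Injective (fn : ↥F → VDSpace F) :=
  fun _ _ h => Sum.inl_injective (Sum.inl_injective h)

theorem nat_injective {F : Set (ℕ → ℕ)} : Function.Injective (nat : ℕ → VDSpace F) :=
  fun _ _ h => Sum.inr_injective (Sum.inl_injective h)

theorem pt_notMem_D {F : Set (ℕ → ℕ)} (p : ↥F × ℕ × ℕ) : pt p ∉ D F := by
  rintro (⟨f, h⟩ | ⟨k, h⟩)
  · exact pt_ne_fn p f h
  · exact pt_ne_nat p k h

theorem fn_mem_D {F : Set (ℕ → ℕ)} (f : ↥F) : fn f ∈ D F := Or.inl ⟨f, rfl⟩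

theorem nat_mem_D {F : Set (ℕ → ℕ)} (k : ℕ) : nat k ∈ D F := Or.inr ⟨k, rfl⟩

theorem isClosed_D (F : Set (ℕ → ℕ)) : IsClosed (D F) := by
  have h : (D F)ᶜ = ⋃ p : ↥F × ℕ × ℕ, {pt p} := by
    ext x
    simp only [Set.mem_compl_iff, Set.mem_iUnion, Set.mem_singleton_iff]
    constructor
    · intro hx
      rcases x with (f | k) | p
      · exact absurd (fn_mem_D f) hx
      · exact absurd (nat_mem_D k) hx
      · exact ⟨p, rfl⟩
    · rintro ⟨p, rfl⟩
      exact pt_notMem_D p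
  rw [← isOpen_compl_iff, h]
  exact isOpen_iUnion isOpen_singleton_pt

theorem basicO_inter_D {F : Set (ℕ → ℕ)} (f : ↥F) (s : Finset (ℕ × ℕ)) :
    basicO f s ∩ D F = {fn f} := by
  refine Set.Subset.antisymm ?_ (Set.singleton_subset_iff.2 ⟨Or.inl rfl, fn_mem_D f⟩)
  rintro x ⟨hx | ⟨m, n, -, -, rfl⟩, hD⟩
  · exact hx
  · exact absurd hD (pt_notMem_D _)

theorem basicU_inter_D {F : Set (ℕ → ℕ)} (k n : ℕ) :
    basicU k n ∩ D F = {nat k} := by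
  refine Set.Subset.antisymm ?_ (Set.singleton_subset_iff.2 ⟨Or.inl rfl, nat_mem_D k⟩)
  rintro x ⟨hx | ⟨g, l, -, rfl⟩, hD⟩
  · exact hx
  · exact absurd hD (pt_notMem_D _)

theorem exists_isOpen_inter_D {F : Set (ℕ → ℕ)} {d : VDSpace F} (hd : d ∈ D F) :
    ∃ V : Set (VDSpace F), IsOpen V ∧ V ∩ D F = {d} := by
  obtain ⟨f, rfl⟩ | ⟨k, rfl⟩ := hd
  · exact ⟨basicO f ∅, isOpen_basicO f ∅, basicO_inter_D f ∅⟩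
  · exact ⟨basicU k 0, isOpen_basicU k 0, basicU_inter_D k 0⟩

theorem basicO_anti {F : Set (ℕ → ℕ)} (f : ↥F) {s t : Finset (ℕ × ℕ)} (h : s ⊆ t) :
    basicO f t ⊆ basicO f s := by
  rintro x (hx | ⟨m, n, hmn, ht, rfl⟩)
  · exact Or.inl hx
  · exact Or.inr ⟨m, n, hmn, fun hs => ht (h hs), rfl⟩

theorem basicU_anti {F : Set (ℕ → ℕ)} (k : ℕ) {m n : ℕ} (h : m ≤ n) :
    (basicU k n : Set (VDSpace F)) ⊆ basicU k m := by
  rintro x (hx | ⟨g, l, hl, rfl⟩)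
  · exact Or.inl hx
  · exact Or.inr ⟨g, l, h.trans hl, rfl⟩

theorem exists_basicO_subset {F : Set (ℕ → ℕ)} {V : Set (VDSpace F)} (hV : IsOpen V)
    {f : ↥F} (hf : fn f ∈ V) : ∃ s, basicO f s ⊆ V := by
  induction hV with
  | basic V hV =>
    obtain (⟨p, rfl⟩ | ⟨f', s, rfl⟩) | ⟨k, n, rfl⟩ := hV
    · exact absurd hf.symm (pt_ne_fn p f)
    · obtain hf | ⟨m, n, -, -, h⟩ := hf
      · obtain rfl := fn_injective hf
        exact ⟨s, subset_rfl⟩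
      · exact absurd h.symm (pt_ne_fn _ f)
    · obtain hf | ⟨g, l, -, h⟩ := hf
      · exact absurd hf (fn_ne_nat f k)
      · exact absurd h.symm (pt_ne_fn _ f)
  | univ => exact ⟨∅, Set.subset_univ _⟩
  | inter V W _ _ ihV ihW =>
    obtain ⟨s, hs⟩ := ihV hf.1
    obtain ⟨t, ht⟩ := ihW hf.2
    exact ⟨s ∪ t, Set.subset_inter ((basicO_anti f Finset.subset_union_left).trans hs)
      ((basicO_anti f Finset.subset_union_right).trans ht)⟩
  | sUnion S _ ih =>
    obtain ⟨V, hVS, hfV⟩ := hf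
    obtain ⟨s, hs⟩ := ih V hVS hfV
    exact ⟨s, hs.trans (Set.subset_sUnion_of_mem hVS)⟩

theorem exists_basicU_subset {F : Set (ℕ → ℕ)} {V : Set (VDSpace F)} (hV : IsOpen V)
    {k : ℕ} (hk : nat k ∈ V) : ∃ n, basicU k n ⊆ V := by
  induction hV with
  | basic V hV =>
    obtain (⟨p, rfl⟩ | ⟨f, s, rfl⟩) | ⟨k', n, rfl⟩ := hV
    · exact absurd hk.symm (pt_ne_nat p k)
    · obtain hk | ⟨m, n, -, -, h⟩ := hk
      · exact absurd hk.symm (fn_ne_nat f k)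
      · exact absurd h.symm (pt_ne_nat _ k)
    · obtain hk | ⟨g, l, -, h⟩ := hk
      · obtain rfl := nat_injective hk
        exact ⟨n, subset_rfl⟩
      · exact absurd h.symm (pt_ne_nat _ k)
  | univ => exact ⟨0, Set.subset_univ _⟩
  | inter V W _ _ ihV ihW =>
    obtain ⟨m, hm⟩ := ihV hk.1
    obtain ⟨n, hn⟩ := ihW hk.2
    exact ⟨max m n, Set.subset_inter ((basicU_anti k (le_max_left m n)).trans hm)
      ((basicU_anti k (le_max_right m n)).trans hn)⟩
  | sUnion S _ ih =>
    obtain ⟨V, hVS, hkV⟩ := hk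
    obtain ⟨n, hn⟩ := ih V hVS hkV
    exact ⟨n, hn.trans (Set.subset_sUnion_of_mem hVS)⟩

/-- A disjoint open expansion of `F ⊔ ℕ` yields a bound of `F` with respect to `≤*`. -/
theorem exists_bound_of_separated {F : Set (ℕ → ℕ)} {U : D F → Set (VDSpace F)}
    (hU : ∀ d : D F, IsOpen (U d) ∧ (d : VDSpace F) ∈ U d)
    (hdisj : ∀ d d' : D F, d ≠ d' → Disjoint (U d) (U d')) :
    ∃ g : ℕ → ℕ, ∀ f ∈ F, EvLE f g := by
  choose g hg using fun k : ℕ =>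
    exists_basicU_subset (hU ⟨nat k, nat_mem_D k⟩).1 (hU ⟨nat k, nat_mem_D k⟩).2
  refine ⟨g, fun f hf => ?_⟩
  obtain ⟨s, hs⟩ := exists_basicO_subset (hU ⟨fn ⟨f, hf⟩, fn_mem_D _⟩).1
    (hU ⟨fn ⟨f, hf⟩, fn_mem_D _⟩).2
  filter_upwards [Filter.eventually_gt_atTop (s.sup Prod.fst)] with m hm
  by_contra! hlt
  have hms : (m, f m) ∉ s := fun h => hm.not_ge (Finset.le_sup (f := Prod.fst) h)
  have hne : (⟨fn ⟨f, hf⟩, fn_mem_D _⟩ : D F) ≠ ⟨nat m, nat_mem_D m⟩ :=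
    fun h => fn_ne_nat _ _ (congrArg Subtype.val h)
  exact Set.disjoint_left.1 (hdisj _ _ hne) (hs (Or.inr ⟨m, f m, rfl, hms, rfl⟩))
    (hg m (Or.inr ⟨⟨f, hf⟩, f m, hlt.le, rfl⟩))

end VDSpace

/-- If `F` is unbounded with respect to `≤*`, then `D = F ⊔ ℕ` is a closed discrete subset of
the van Douwen space `X_F` which cannot be separated by pairwise disjoint open sets; in
particular, `X_F` is not collectionwise Hausdorff. -/
theorem vanDouwen_not_collectionwiseHausdorff (F : Set (ℕ → ℕ))
    (hF : ¬ ∃ g : ℕ → ℕ, ∀ f ∈ F, EvLE f g) :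
    IsClosed (VDSpace.D F) ∧
    (∀ d ∈ VDSpace.D F, ∃ V : Set (VDSpace F), IsOpen V ∧ V ∩ VDSpace.D F = {d}) ∧
    (¬ ∃ U : (VDSpace.D F) → Set (VDSpace F),
        (∀ d : VDSpace.D F, IsOpen (U d) ∧ (d : VDSpace F) ∈ U d) ∧
        ∀ d d' : VDSpace.D F, d ≠ d' → Disjoint (U d) (U d')) ∧
    ¬ CollectionwiseHausdorff (VDSpace F) := by
  have hsep : ¬ ∃ U : (VDSpace.D F) → Set (VDSpace F),
      (∀ d : VDSpace.D F, IsOpen (U d) ∧ (d : VDSpace F) ∈ U d) ∧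
      ∀ d d' : VDSpace.D F, d ≠ d' → Disjoint (U d) (U d') :=
    fun ⟨_, hU, hdisj⟩ => hF (VDSpace.exists_bound_of_separated hU hdisj)
  have hdiscrete : ∀ d ∈ VDSpace.D F,
      ∃ V : Set (VDSpace F), IsOpen V ∧ V ∩ VDSpace.D F = {d} :=
    fun _ hd => VDSpace.exists_isOpen_inter_D hd
  exact ⟨VDSpace.isClosed_D F, hdiscrete, hsep,
    fun h => hsep (h _ (VDSpace.isClosed_D F) hdiscrete)⟩
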